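/- Let a₂⁺ be the 1-form on ℝ² given by a₂⁺(x,y)(v) = x·v₁ + y·v₂, with rotational vector field X(x,y) = (−y, x) spanning its kernel away from the origin. Let f be a smooth function near 0 ∈ ℝ² with f(0,0) = 0 and ∇f(0,0) ≠ (0,0) (the zero curve of f is regular at the origin). Then there exist a local diffeomorphism φ = (φ₁, φ₂) at 0 with φ(0) = 0 and smooth nonvanishing functions κ, λ near 0 such that a₂⁺ = κ·φ*(a₂⁺) and f = λ·φ₁ near the origin. Consequently f·X is orbitally a₂⁺-conjugate to x·X, i.e. to the vector field (−xy, x²). -/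

import Mathlib

noncomputable section

/-- The 1-form `a₂⁺(x,y)(v) = x·v₁ + y·v₂`. -/
def a2p : ℝ × ℝ → ((ℝ × ℝ) →L[ℝ] ℝ) :=
  fun p => p.1 • ContinuousLinearMap.fst ℝ ℝ ℝ + p.2 • ContinuousLinearMap.snd ℝ ℝ ℝ

/-- The rotational vector field `X(x,y) = (−y, x)` spanning the kernel of `a₂⁺`
away from the origin. -/
def Xrot : ℝ × ℝ → ℝ × ℝ := fun p => (-p.2, p.1)

open MeasureTheory Set in
/-- Integrals over `[0, 1]` depending smoothly on a parameter are smooth in this parameter. -/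
theorem contDiff_integral_zero_one_of_contDiff {E F : Type*} [NormedAddCommGroup E]
    [NormedSpace ℝ E] [NormedAddCommGroup F] [NormedSpace ℝ F] {n : ℕ∞} {g : E → ℝ → F}
    (hg : ContDiff ℝ n (Function.uncurry g)) :
    ContDiff ℝ n fun p => ∫ t in (0 : ℝ)..1, g p t := by
  let χ : ContDiffBump (0 : ℝ) := ⟨1, 2, one_pos, one_lt_two⟩
  have hχ : ∀ t ∈ Ioc (0 : ℝ) 1, χ t = 1 := fun t ht =>
    χ.one_of_mem_closedBall (by simpa [abs_of_pos ht.1] using ht.2)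
  have hint : LocallyIntegrable ((Icc (-1 : ℝ) 0).indicator fun _ => (1 : ℝ)) volume :=
    ((integrable_indicator_iff measurableSet_Icc).2
      (integrableOn_const (by simp))).locallyIntegrable
  have key := contDiffOn_convolution_left_with_param_comp (n := n) (μ := (volume : Measure ℝ))
    (ContinuousLinearMap.lsmul ℝ ℝ : ℝ →L[ℝ] F →L[ℝ] F).flip (s := univ)
    (v := fun _ : E => (0 : ℝ)) contDiffOn_const
    (g := fun p t => χ t • g p t) isOpen_univ (isCompact_closedBall (0 : ℝ) 2)
    (fun p t _ ht => by
      have : χ t = 0 := χ.zero_of_le_dist (not_le.1 ht).le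
      simp [this]) hint
    (((χ.contDiff.comp contDiff_snd).smul hg).contDiffOn)
  rw [contDiffOn_univ] at key
  convert key using 2 with p
  rw [intervalIntegral.integral_of_le zero_le_one, ← integral_Icc_eq_integral_Ioc,
    ← integral_indicator measurableSet_Icc, convolution]
  refine integral_congr_ae ?_
  filter_upwards [compl_mem_ae_iff.2 (measure_singleton (0 : ℝ))] with t ht
  by_cases h : t ∈ Icc (0 : ℝ) 1
  · have h' : 0 - t ∈ Icc (-1 : ℝ) 0 := ⟨by linarith [h.2], by linarith [h.1]⟩
    rw [indicator_of_mem h, indicator_of_mem h']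
    simp [hχ t ⟨lt_of_le_of_ne h.1 (Ne.symm ht), h.2⟩]
  · have h' : 0 - t ∉ Icc (-1 : ℝ) 0 := fun h' => h ⟨by linarith [h'.2], by linarith [h'.1]⟩
    rw [indicator_of_notMem h, indicator_of_notMem h']
    simp

/-- Hadamard's lemma. -/
theorem exists_contDiff_eq_apply_self {E F : Type*} [NormedAddCommGroup E] [NormedSpace ℝ E]
    [NormedAddCommGroup F] [NormedSpace ℝ F] [CompleteSpace F] {f : E → F}
    (hf : ContDiff ℝ (⊤ : ℕ∞) f) (hf0 : f 0 = 0) :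
    ∃ A : E → E →L[ℝ] F, ContDiff ℝ (⊤ : ℕ∞) A ∧ A 0 = fderiv ℝ f 0 ∧ ∀ p, f p = A p p := by
  have hf' : ContDiff ℝ (⊤ : ℕ∞) (fderiv ℝ f) := hf.fderiv_right (by simp)
  refine ⟨fun p => ∫ t in (0 : ℝ)..1, fderiv ℝ f (t • p),
    contDiff_integral_zero_one_of_contDiff (hf'.comp (contDiff_snd.smul contDiff_fst)),
    by simp, fun p => ?_⟩
  have hc : Continuous fun t : ℝ => fderiv ℝ f (t • p) :=
    hf'.continuous.comp (continuous_id.smul continuous_const)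
  rw [ContinuousLinearMap.intervalIntegral_apply (hc.intervalIntegrable 0 1),
    intervalIntegral.integral_eq_sub_of_hasDerivAt (f := fun t : ℝ => f (t • p)) _
      ((hc.clm_apply continuous_const).intervalIntegrable 0 1)]
  · simp [hf0]
  · intro t _
    have h1 : HasDerivAt (fun t : ℝ => t • p) p t := by
      simpa using (hasDerivAt_id t).smul_const p
    exact ((hf.differentiable (by simp)) (t • p)).hasFDerivAt.comp_hasDerivAt t h1

/-- A function smooth near a point agrees near this point with a globally smooth one. -/
theorem exists_contDiff_eventuallyEq {E F : Type*} [NormedAddCommGroup E] [NormedSpace ℝ E]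
    [HasContDiffBump E] [FiniteDimensional ℝ E] [NormedAddCommGroup F] [NormedSpace ℝ F]
    {n : ℕ∞} {f : E → F} {U : Set E} {c : E} (hU : IsOpen U) (hc : c ∈ U)
    (hf : ContDiffOn ℝ n f U) : ∃ g : E → F, ContDiff ℝ n g ∧ g =ᶠ[nhds c] f := by
  obtain ⟨ε, hε, hεU⟩ := Metric.isOpen_iff.1 hU c hc
  let χ : ContDiffBump c := ⟨ε / 4, ε / 2, by positivity, by linarith⟩
  refine ⟨fun p => χ p • f p, contDiff_iff_contDiffAt.2 fun p => ?_, ?_⟩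
  · by_cases hp : p ∈ U
    · exact χ.contDiffAt.smul (hf.contDiffAt (hU.mem_nhds hp))
    · have hp' : p ∉ tsupport χ := fun h => hp <| hεU <| by
        rw [χ.tsupport_eq] at h
        exact Metric.closedBall_subset_ball (by change ε / 2 < ε; linarith) h
      refine (contDiffAt_const (c := (0 : F))).congr_of_eventuallyEq ?_
      filter_upwards [notMem_tsupport_iff_eventuallyEq.1 hp'] with q hq
      simp [hq]
  · filter_upwards [χ.eventuallyEq_one] with p hp
    simp [hp]

theorem ContinuousLinearMap.det_real_prod (M : ℝ × ℝ →L[ℝ] ℝ × ℝ) :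
    M.det = (M (1, 0)).1 * (M (0, 1)).2 - (M (0, 1)).1 * (M (1, 0)).2 := by
  rw [ContinuousLinearMap.det, ← LinearMap.det_toMatrix (Module.Basis.finTwoProd ℝ),
    Matrix.det_fin_two]
  simp [LinearMap.toMatrix_apply]

theorem ContinuousLinearMap.apply_real_prod (M : ℝ × ℝ →L[ℝ] ℝ × ℝ) (p : ℝ × ℝ) :
    M p = p.1 • M (1, 0) + p.2 • M (0, 1) := by
  rw [← map_smul, ← map_smul, ← map_add]
  simp

theorem a2p_apply (p v : ℝ × ℝ) : a2p p v = p.1 * v.1 + p.2 * v.2 := by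
  simp [a2p]

/-- A linear map pulling `a2p q` back to `a2p p` maps `Xrot p` to a multiple of `Xrot q`, with
factor its determinant. -/
theorem apply_Xrot_of_a2p_eq_comp {M : ℝ × ℝ →L[ℝ] ℝ × ℝ} {p q : ℝ × ℝ}
    (h : a2p p = (a2p q).comp M) : M (Xrot p) = M.det • Xrot q := by
  have h1 := DFunLike.congr_fun h (1, 0)
  have h2 := DFunLike.congr_fun h (0, 1)
  simp only [ContinuousLinearMap.comp_apply, a2p_apply, mul_one, mul_zero, add_zero,
    zero_add] at h1 h2
  rw [M.apply_real_prod, M.det_real_prod]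
  ext
  · simp only [Xrot, h1, h2, Prod.fst_add, Prod.smul_fst, smul_eq_mul]
    ring
  · simp only [Xrot, h1, h2, Prod.snd_add, Prod.smul_snd, smul_eq_mul]
    ring

/-- A map preserving the distance to the origin pulls `a2p` back to itself. -/
theorem a2p_eq_comp_fderiv {φ : ℝ × ℝ → ℝ × ℝ} {p : ℝ × ℝ} (hφ : DifferentiableAt ℝ φ p)
    (h : ∀ᶠ q in nhds p, (φ q).1 ^ 2 + (φ q).2 ^ 2 = q.1 ^ 2 + q.2 ^ 2) :
    a2p p = (a2p (φ p)).comp (fderiv ℝ φ p) := by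
  have h1 := (hφ.hasFDerivAt.fst.pow 2).add (hφ.hasFDerivAt.snd.pow 2)
  have h2 := ((hasFDerivAt_fst (𝕜 := ℝ) (p := p)).pow 2).add
    ((hasFDerivAt_snd (𝕜 := ℝ) (p := p)).pow 2)
  have h3 := h1.unique (h2.congr_of_eventuallyEq h)
  refine ContinuousLinearMap.ext fun v => ?_
  have h4 := DFunLike.congr_fun h3 v
  simp [mul_assoc] at h4
  rw [ContinuousLinearMap.comp_apply, a2p_apply, a2p_apply]
  linarith

theorem hasFDerivAt_fst_mul_add_snd_mul_zero {a b : ℝ × ℝ → ℝ} (ha : DifferentiableAt ℝ a 0)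
    (hb : DifferentiableAt ℝ b 0) :
    HasFDerivAt (fun p : ℝ × ℝ => a p * p.1 + b p * p.2)
      (a 0 • ContinuousLinearMap.fst ℝ ℝ ℝ + b 0 • ContinuousLinearMap.snd ℝ ℝ ℝ) 0 := by
  refine ((ha.hasFDerivAt.mul (hasFDerivAt_fst (𝕜 := ℝ))).add
    (hb.hasFDerivAt.mul (hasFDerivAt_snd (𝕜 := ℝ)))).congr_fderiv ?_
  simp

/-- Rotating each point `p` by the matrix with rows `(a p, b p)` and `(-b p, a p)`. -/
def rotateBy (a b : ℝ × ℝ → ℝ) (p : ℝ × ℝ) : ℝ × ℝ :=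
  (a p * p.1 + b p * p.2, -b p * p.1 + a p * p.2)

theorem rotateBy_sq_add_sq {a b : ℝ × ℝ → ℝ} {p : ℝ × ℝ} (h : a p ^ 2 + b p ^ 2 = 1) :
    (rotateBy a b p).1 ^ 2 + (rotateBy a b p).2 ^ 2 = p.1 ^ 2 + p.2 ^ 2 := by
  simp only [rotateBy]
  linear_combination (p.1 ^ 2 + p.2 ^ 2) * h

theorem det_fderiv_rotateBy_zero {a b : ℝ × ℝ → ℝ} (ha : DifferentiableAt ℝ a 0)
    (hb : DifferentiableAt ℝ b 0) :
    (fderiv ℝ (rotateBy a b) 0).det = a 0 ^ 2 + b 0 ^ 2 := by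
  have h : HasFDerivAt (rotateBy a b) _ 0 :=
    (hasFDerivAt_fst_mul_add_snd_mul_zero ha hb).prodMk
      (hasFDerivAt_fst_mul_add_snd_mul_zero hb.neg ha)
  rw [h.fderiv, ContinuousLinearMap.det_real_prod]
  simp
  ring

/-- If `f` is smooth near `0 ∈ ℝ²` with `f(0,0) = 0` and `∇f(0,0) ≠ 0` (zero curve
regular at the origin), then there are a local diffeomorphism `φ = (φ₁, φ₂)`
fixing `0` and smooth nonvanishing `κ, λ` with `a₂⁺ = κ·φ*(a₂⁺)` and `f = λ·φ₁`
near the origin. Consequently `f·X` is orbitally `a₂⁺`-conjugate to `x·X`, i.e.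
to the vector field `(−xy, x²)`. -/
theorem stmt_16 (U : Set (ℝ × ℝ)) (hUo : IsOpen U) (hU0 : (0 : ℝ × ℝ) ∈ U)
    (f : ℝ × ℝ → ℝ) (hf : ContDiffOn ℝ (⊤ : ℕ∞) f U)
    (hf0 : f 0 = 0) (hdf : fderiv ℝ f 0 ≠ 0) :
    ∃ (φ : ℝ × ℝ → ℝ × ℝ) (W : Set (ℝ × ℝ)) (κ lam : ℝ × ℝ → ℝ),
      IsOpen W ∧ (0 : ℝ × ℝ) ∈ W ∧ φ 0 = 0 ∧
      ContDiffOn ℝ (⊤ : ℕ∞) φ W ∧ (∀ p ∈ W, (fderiv ℝ φ p).det ≠ 0) ∧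
      ContDiffOn ℝ (⊤ : ℕ∞) κ W ∧ (∀ p ∈ W, κ p ≠ 0) ∧
      ContDiffOn ℝ (⊤ : ℕ∞) lam W ∧ (∀ p ∈ W, lam p ≠ 0) ∧
      -- a₂⁺ = κ·φ*(a₂⁺)
      (∀ p ∈ W, a2p p = κ p • ((a2p (φ p)).comp (fderiv ℝ φ p))) ∧
      -- f = λ·φ₁
      (∀ p ∈ W, f p = lam p * (φ p).1) ∧
      -- consequently f·X is orbitally a₂⁺-conjugate to x·X = (−xy, x²)
      (∃ μ : ℝ × ℝ → ℝ, ContDiffOn ℝ (⊤ : ℕ∞) μ W ∧ (∀ p ∈ W, μ p ≠ 0) ∧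
        ∀ p ∈ W, f p • Xrot p =
          μ p • (fderiv ℝ φ p).inverse ((φ p).1 • Xrot (φ p))) := by
  obtain ⟨g, hg, hgf⟩ := exists_contDiff_eventuallyEq hUo hU0 hf
  obtain ⟨A, hA, hA0, hgA⟩ := exists_contDiff_eq_apply_self hg (hgf.eq_of_nhds.trans hf0)
  rw [hgf.fderiv_eq] at hA0
  obtain ⟨B, hBf, hBo, hB0⟩ := eventually_nhds_iff.1 hgf
  set a : ℝ × ℝ → ℝ := fun p => A p (1, 0) with ha
  set b : ℝ × ℝ → ℝ := fun p => A p (0, 1) with hb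
  have hac : ContDiff ℝ (⊤ : ℕ∞) a := hA.clm_apply contDiff_const
  have hbc : ContDiff ℝ (⊤ : ℕ∞) b := hA.clm_apply contDiff_const
  have hgab : ∀ p, g p = a p * p.1 + b p * p.2 := fun p => by
    have : p = p.1 • ((1 : ℝ), (0 : ℝ)) + p.2 • ((0 : ℝ), (1 : ℝ)) := by simp
    rw [hgA p]
    conv_lhs => rw [this, map_add, map_smul, map_smul, ← this]
    simp only [smul_eq_mul, ha, hb]
    ring
  set N : ℝ × ℝ → ℝ := fun p => a p ^ 2 + b p ^ 2
  have hNc : ContDiff ℝ (⊤ : ℕ∞) N := (hac.pow 2).add (hbc.pow 2)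
  have hN0 : 0 < N 0 := by
    refine lt_of_le_of_ne (by positivity) fun h => hdf ?_
    have h1 : a 0 = 0 := by
      refine pow_eq_zero_iff two_ne_zero |>.1 ?_
      nlinarith [sq_nonneg (a 0), sq_nonneg (b 0)]
    have h2 : b 0 = 0 := by
      refine pow_eq_zero_iff two_ne_zero |>.1 ?_
      nlinarith [sq_nonneg (a 0), sq_nonneg (b 0)]
    rw [← hA0]
    ext
    · simpa [ha] using h1
    · simpa [hb] using h2
  set V : Set (ℝ × ℝ) := {p | 0 < N p}
  have hVo : IsOpen V := isOpen_lt continuous_const hNc.continuous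
  set s : ℝ × ℝ → ℝ := fun p => √(N p)
  have hsV : ∀ p ∈ V, s p ≠ 0 := fun p hp => (Real.sqrt_pos.2 hp).ne'
  have hsc : ContDiffOn ℝ (⊤ : ℕ∞) s V := hNc.contDiffOn.sqrt fun p hp => (ne_of_gt hp)
  set α : ℝ × ℝ → ℝ := fun p => a p / s p with hα
  set β : ℝ × ℝ → ℝ := fun p => b p / s p with hβ
  have hαc : ContDiffOn ℝ (⊤ : ℕ∞) α V := hac.contDiffOn.div hsc hsV
  have hβc : ContDiffOn ℝ (⊤ : ℕ∞) β V := hbc.contDiffOn.div hsc hsV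
  have hαβ : ∀ p ∈ V, α p ^ 2 + β p ^ 2 = 1 := fun p hp => by
    have : s p ^ 2 = N p := Real.sq_sqrt (le_of_lt hp)
    have h0 := hsV p hp
    simp only [hα, hβ, div_pow, this, ← add_div]
    exact div_self (ne_of_gt hp)
  set φ := rotateBy α β with hφ
  have hφc : ContDiffOn ℝ (⊤ : ℕ∞) φ V :=
    ((hαc.mul contDiffOn_fst).add (hβc.mul contDiffOn_snd)).prodMk
      ((hβc.neg.mul contDiffOn_fst).add (hαc.mul contDiffOn_snd))
  have hφd : ∀ p ∈ V, DifferentiableAt ℝ φ p := fun p hp =>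
    (hφc.contDiffAt (hVo.mem_nhds hp)).differentiableAt (by simp)
  have hDc : ContDiffOn ℝ (⊤ : ℕ∞) (fderiv ℝ φ) V := hφc.fderiv_of_isOpen hVo (by simp)
  have hdet : ContDiffOn ℝ (⊤ : ℕ∞) (fun p => (fderiv ℝ φ p).det) V := by
    have h1 := hDc.clm_apply (contDiffOn_const (c := ((1 : ℝ), (0 : ℝ))))
    have h2 := hDc.clm_apply (contDiffOn_const (c := ((0 : ℝ), (1 : ℝ))))
    simp only [ContinuousLinearMap.det_real_prod]
    exact (h1.fst.mul h2.snd).sub (h2.fst.mul h1.snd)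
  have hpull : ∀ p ∈ V, a2p p = (a2p (φ p)).comp (fderiv ℝ φ p) := fun p hp =>
    a2p_eq_comp_fderiv (hφd p hp) <| by
      filter_upwards [hVo.mem_nhds hp] with q hq
      exact rotateBy_sq_add_sq (hαβ q hq)
  have hfφ : ∀ p ∈ V ∩ B, f p = s p * (φ p).1 := fun p hp => by
    rw [← hBf p hp.2, hgab]
    have := hsV p hp.1
    simp only [hφ, rotateBy, hα, hβ]
    field_simp
  set W := B ∩ (V ∩ {p | (fderiv ℝ φ p).det ≠ 0})
  have hWV : W ⊆ V := fun p hp => hp.2.1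
  refine ⟨φ, W, fun _ => 1, s,
    hBo.inter (hdet.continuousOn.isOpen_inter_preimage hVo isOpen_ne), ⟨hB0, hN0, ?_⟩,
    by simp [hφ, rotateBy], hφc.mono hWV, fun p hp => hp.2.2, contDiffOn_const,
    fun _ _ => one_ne_zero, hsc.mono hWV, fun p hp => hsV p (hWV hp),
    fun p hp => by rw [one_smul]; exact hpull p (hWV hp), fun p hp => hfφ p ⟨hWV hp, hp.1⟩,
    fun p => s p * (fderiv ℝ φ p).det, (hsc.mul hdet).mono hWV,
    fun p hp => mul_ne_zero (hsV p (hWV hp)) hp.2.2, fun p hp => ?_⟩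
  · have h0 := hVo.mem_nhds hN0
    change (fderiv ℝ φ 0).det ≠ 0
    rw [hφ, det_fderiv_rotateBy_zero ((hαc.contDiffAt h0).differentiableAt (by simp))
      ((hβc.contDiffAt h0).differentiableAt (by simp)), hαβ 0 hN0]
    exact one_ne_zero
  · set M := fderiv ℝ φ p
    let e := M.toContinuousLinearEquivOfDetNeZero hp.2.2
    have he : (e : ℝ × ℝ →L[ℝ] ℝ × ℝ) = M := M.coe_toContinuousLinearEquivOfDetNeZero hp.2.2
    have hX : e (Xrot p) = M.det • Xrot (φ p) := apply_Xrot_of_a2p_eq_comp (hpull p (hWV hp))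
    rw [← he, ContinuousLinearMap.inverse_equiv]
    apply e.injective
    change e (f p • Xrot p) = e (_ • e.symm _)
    rw [map_smul, map_smul, e.apply_symm_apply, hX, hfφ p ⟨hWV hp, hp.1⟩, smul_smul, smul_smul]
    congr 1
    ring
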